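/- arXiv:1511.09259 — 3 statements merged into one kernel-verified Lean document; each statement's English description precedes it below -/
import Mathlib

section
/- (Lower bound for the alternating stock size problem.) With the barrier notation below, assume n_a > n_b. Then for every s ∈ {1,…,n_a−n_b}, the optimal value S* of the alternating stock size problem satisfies S* ≥ (1/(n_a−n_b−s+1)) · ( 2·Σ_{i=s}^{n_a−n_b} a'_i − Σ_{i=s}^{n_a−n_b} w'_i + Σ_{i=1}^{h} (v_i − w_i) ). -/
open Finset in
/-- The `#K` smallest terms of an antitone sequence bound from below any sum over `K`. -/
theorem sum_range_card_le_sum {f : ℕ → ℝ} (N : ℕ) {K : Finset ℕ}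
    (hf : ∀ i j, 1 ≤ i → i ≤ j → j ≤ N → f j ≤ f i) (hK : K ⊆ Icc 1 N) :
    ∑ i ∈ range #K, f (N - i) ≤ ∑ i ∈ K, f i := by
  induction K using Finset.induction_on_max generalizing N with
  | empty => simp
  | insert a K ha ih =>
    have haK : a ∉ K := fun h => lt_irrefl _ (ha a h)
    have haN := mem_Icc.1 (hK (mem_insert_self a K))
    have := ih (N - 1) (fun i j h1 h2 h3 => hf i j h1 h2 (by omega)) (fun i hi => by
      have h1 := mem_Icc.1 (hK (mem_insert_of_mem hi))
      have h2 := ha i hi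
      exact mem_Icc.2 ⟨h1.1, by omega⟩)
    rw [card_insert_of_notMem haK, sum_insert haK, sum_range_succ', add_comm]
    refine add_le_add (hf a N haN.1 haN.2 le_rfl) (le_trans (le_of_eq ?_) this)
    exact sum_congr rfl fun i _ => by congr 1; omega

open Finset in
/-- The `#K` largest terms past index `L` of an antitone sequence bound from above any sum over
a set `K` of indices past `L`. -/
theorem sum_le_sum_range_card {f : ℕ → ℝ} {n : ℕ} (L : ℕ) {K : Finset ℕ}
    (hf : ∀ i j, 1 ≤ i → i ≤ j → j ≤ n → f j ≤ f i) (hK : K ⊆ Ioc L n) :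
    ∑ i ∈ K, f i ≤ ∑ i ∈ range #K, f (L + 1 + i) := by
  induction K using Finset.induction_on_min generalizing L with
  | empty => simp
  | insert a K ha ih =>
    have haK : a ∉ K := fun h => lt_irrefl _ (ha a h)
    have haN := mem_Ioc.1 (hK (mem_insert_self a K))
    have := ih (L + 1) (fun i hi => by
      have h1 := mem_Ioc.1 (hK (mem_insert_of_mem hi))
      have h2 := ha i hi
      exact mem_Ioc.2 ⟨by omega, h1.2⟩)
    rw [card_insert_of_notMem haK, sum_insert haK, sum_range_succ', add_comm (f a)]
    refine add_le_add (le_trans this (le_of_eq ?_)) (hf _ _ (by omega) (by omega) haN.2)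
    exact sum_congr rfl fun i _ => by congr 1; omega

/-- A sequence that is negative before `h` and nonnegative on `[h, k)` has its smallest partial
sum of length at most `k` at `h`. -/
theorem sum_range_le_of_sign_change {d : ℕ → ℝ} {h k q : ℕ} (hq : q ≤ k)
    (hneg : ∀ i < h, d i < 0) (hpos : ∀ i, h ≤ i → i < k → 0 ≤ d i) :
    ∑ i ∈ Finset.range h, d i ≤ ∑ i ∈ Finset.range q, d i := by
  rcases le_total h q with hle | hle
  · refine Finset.sum_le_sum_of_subset_of_nonneg (Finset.range_subset_range.2 hle) ?_
    intro i hi hi'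
    simp only [Finset.mem_range] at hi hi'
    exact hpos i (by omega) (by omega)
  · rw [← Finset.sum_range_add_sum_Ico _ hle]
    have : ∑ i ∈ Finset.Ico q h, d i ≤ 0 :=
      Finset.sum_nonpos fun i hi => (hneg i (Finset.mem_Ico.1 hi).2).le
    linarith

/-- A function that separates residues modulo `n` is injective on intervals of length `n`. -/
theorem injOn_Ico_of_modEq {n : ℕ} {ξ : ℕ → ℕ} (hξ : ∀ i j, ξ i = ξ j → i ≡ j [MOD n]) (a : ℕ) :
    Set.InjOn ξ (Finset.Ico a (a + n) : Finset ℕ) := by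
  intro i hi j hj hij
  simp only [Finset.coe_Ico, Set.mem_Ico] at hi hj
  have key : ∀ i j, i ≤ j → j < i + n → i ≡ j [MOD n] → i = j := by
    intro i j hle hlt hmod
    have := Nat.eq_zero_of_dvd_of_lt ((Nat.modEq_iff_dvd' hle).1 hmod) (by omega)
    omega
  rcases le_total i j with hle | hle
  · exact key i j hle (by omega) (hξ _ _ hij)
  · exact (key j i hle (by omega) (hξ _ _ hij).symm).symm

open Finset in
/-- An `n`-periodic enumeration of `[1, n]` meets `[1, m]` exactly `m` times in each period. -/
theorem card_filter_Ico_le {n m : ℕ} (hm : m ≤ n) {ξ : ℕ → ℕ} (hξ : ∀ i, ξ i ∈ Icc 1 n)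
    (hmod : ∀ i j, ξ i = ξ j → i ≡ j [MOD n]) (a : ℕ) :
    #{i ∈ Ico a (a + n) | ξ i ≤ m} = m := by
  have hinj := injOn_Ico_of_modEq hmod a
  have himg : (Ico a (a + n)).image ξ = Icc 1 n :=
    eq_of_subset_of_card_le (image_subset_iff.2 fun i _ => hξ i)
      (by rw [card_image_of_injOn hinj]; simp)
  have : ({i ∈ Ico a (a + n) | ξ i ≤ m}).image ξ = Icc 1 m := by
    ext j
    simp only [mem_image, mem_filter]
    constructor
    · rintro ⟨i, ⟨_, hi⟩, rfl⟩
      exact mem_Icc.2 ⟨(mem_Icc.1 (hξ i)).1, hi⟩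
    · intro hj
      rw [mem_Icc] at hj
      obtain ⟨i, hi, rfl⟩ := mem_image.1 (himg ▸ mem_Icc.2 ⟨hj.1, hj.2.trans hm⟩)
      exact ⟨i, ⟨hi, hj.2⟩, rfl⟩
  rw [← card_image_of_injOn (hinj.mono (coe_subset.2 (filter_subset _ _))), this]
  simp

open Finset in
/-- The positions of the indices `≤ m` of an `n`-periodic enumeration of `[1, n]`, in increasing
order. -/
theorem exists_strictMono_positions {n m : ℕ} (hm : m ≤ n) (hm0 : 0 < m) {ξ : ℕ → ℕ}
    (hξ : ∀ i, ξ i ∈ Icc 1 n) (hmod : ∀ i j, ξ i = ξ j ↔ i ≡ j [MOD n]) :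
    ∃ p : ℕ → ℕ, StrictMono p ∧ (∀ j, ξ (p j) ≤ m) ∧
      (∀ j i, p j < i → i < p (j + 1) → m < ξ i) ∧ p m = p 0 + n := by
  have hcard := card_filter_Ico_le hm hξ fun i j => (hmod i j).1
  have hinf : {i | ξ i ≤ m}.Infinite := by
    rw [Set.infinite_iff_exists_gt]
    intro a
    have : 0 < #{i ∈ Ico (a + 1) (a + 1 + n) | ξ i ≤ m} := by rw [hcard]; exact hm0
    obtain ⟨i, hi⟩ := card_pos.1 this
    simp only [mem_filter, mem_Ico] at hi
    exact ⟨i, hi.2, by omega⟩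
  have hmono := Nat.nth_strictMono hinf
  refine ⟨Nat.nth fun i => ξ i ≤ m, hmono, fun j => Nat.nth_mem_of_infinite hinf j, ?_, ?_⟩
  · intro j i hi hi'
    by_contra hle
    rw [← Nat.nth_count (p := fun i => ξ i ≤ m) (not_lt.1 hle)] at hi hi'
    have h1 := hmono.lt_iff_lt.1 hi
    have h2 := hmono.lt_iff_lt.1 hi'
    omega
  · set a := Nat.nth (fun i => ξ i ≤ m) 0 with ha
    have hmem : ξ (a + n) ≤ m := by
      rw [(hmod (a + n) a).2 (by simp [Nat.ModEq])]
      exact Nat.nth_mem_of_infinite hinf 0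
    have hcount : Nat.count (fun i => ξ i ≤ m) (a + n) = m := by
      have h0 : Nat.count (fun i => ξ i ≤ m) a = 0 := Nat.count_nth_of_infinite hinf 0
      rw [Nat.count_eq_card_filter_range] at h0 ⊢
      rw [range_eq_Ico, ← Ico_union_Ico_eq_Ico (Nat.zero_le a) (Nat.le_add_right a n),
        filter_union, card_union_of_disjoint, ← range_eq_Ico, h0, hcard, zero_add]
      exact disjoint_filter_filter (Ico_disjoint_Ico_consecutive _ _ _)
    have := Nat.nth_count (p := fun i => ξ i ≤ m) hmem
    rwa [hcount] at this

open Finset in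
/-- Lower bound on the peak stock `M` of a periodic alternating ordering. The stock before step `i`
is `A i`, step `i` first adds `x (ξ i)` and then removes `y (η i)`. The `r` on the right-hand side
counts the steps between consecutive big items that contribute to the bound. -/
theorem exists_periodic_stock_bound {n na L : ℕ} (hna : na ≤ n) (hL : L < na)
    {x y A : ℕ → ℝ} {ξ η : ℕ → ℕ} {M : ℝ}
    (hx : ∀ i j, 1 ≤ i → i ≤ j → j ≤ n → x j ≤ x i)
    (hy : ∀ i j, 1 ≤ i → i ≤ j → j ≤ n → y j ≤ y i)
    (hξ : ∀ i, ξ i ∈ Icc 1 n) (hη : ∀ i, η i ∈ Icc 1 n)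
    (hξmod : ∀ i j, ξ i = ξ j ↔ i ≡ j [MOD n]) (hηmod : ∀ i j, η i = η j ↔ i ≡ j [MOD n])
    (hA : ∀ i, 0 ≤ A i) (hstep : ∀ i, A (i + 1) = A i + (x (ξ i) - y (η i)))
    (hM : ∀ i, A i + x (ξ i) ≤ M) :
    ∃ r ≤ n - na, 2 * ∑ i ∈ range (na - L), x (na - i) - ∑ i ∈ range (na - L), y (L + 1 + i)
      + ∑ i ∈ range r, (x (n - i) - y (na + 1 + i)) ≤ (na - L : ℕ) * M := by
  obtain ⟨p, hmono, hbig, hsmall, hlast⟩ :=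
    exists_strictMono_positions hna (by omega) hξ hξmod
  have hξinj := injOn_Ico_of_modEq fun i j => (hξmod i j).1
  have hηinj := injOn_Ico_of_modEq fun i j => (hηmod i j).1
  have hwindow : ∀ j < na, ∀ i ∈ Ico (p j) (p (j + 1)), i ∈ Ico (p 0) (p 0 + n) := by
    intro j hj i hi
    have h1 := hmono.monotone (Nat.zero_le j)
    have h2 := hmono.monotone (show j + 1 ≤ na by omega)
    simp only [mem_Ico] at hi ⊢
    omega
  have hdisj : ∀ j j' i, i ∈ Ico (p j) (p (j + 1)) → i ∈ Ico (p j') (p (j' + 1)) → j = j' := by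
    intro j j' i hi hi'
    simp only [mem_Ico] at hi hi'
    have h1 := hmono.lt_iff_lt.1 (hi.1.trans_lt hi'.2)
    have h2 := hmono.lt_iff_lt.1 (hi'.1.trans_lt hi.2)
    omega
  obtain ⟨bad, hmembad⟩ : ∃ bad : Finset ℕ, ∀ j,
      j ∈ bad ↔ j < na ∧ ∃ i ∈ Ico (p j) (p (j + 1)), η i ≤ L :=
    ⟨(Set.finite_lt_nat na |>.subset fun _ h => h.1).toFinset,
      fun _ => Set.Finite.mem_toFinset _⟩
  have hbad : #bad ≤ L := by
    have hex : ∀ j : ℕ, ∃ i, j ∈ bad → i ∈ Ico (p j) (p (j + 1)) ∧ η i ≤ L := by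
      intro j
      by_cases hj : j ∈ bad
      · obtain ⟨i, hi⟩ := ((hmembad j).1 hj).2
        exact ⟨i, fun _ => hi⟩
      · exact ⟨0, fun h => absurd h hj⟩
    choose g hg using hex
    calc #bad ≤ #(Icc 1 L) := by
          refine card_le_card_of_injOn (fun j => η (g j)) (fun j hj => ?_) ?_
          · exact mem_coe.2 (mem_Icc.2 ⟨(mem_Icc.1 (hη _)).1, (hg j hj).2⟩)
          · intro j hj j' hj' h
            have e := hηinj (p 0)
              (mem_coe.2 (hwindow j ((hmembad j).1 hj).1 _ (hg j hj).1))
              (mem_coe.2 (hwindow j' ((hmembad j').1 hj').1 _ (hg j' hj').1)) h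
            exact hdisj j j' _ (hg j hj).1 (e ▸ (hg j' hj').1)
      _ = L := by simp
  obtain ⟨G, hGsub, hGcard⟩ : ∃ G ⊆ range na \ bad, #G = na - L := by
    apply exists_subset_card_eq
    have := le_card_sdiff bad (range na)
    rw [card_range] at this
    omega
  have hGna : ∀ j ∈ G, j < na := fun j hj => mem_range.1 (mem_sdiff.1 (hGsub hj)).1
  have hGη : ∀ j ∈ G, ∀ i ∈ Ico (p j) (p (j + 1)), L < η i := by
    intro j hj i hi
    by_contra hle
    exact (mem_sdiff.1 (hGsub hj)).2
      ((hmembad j).2 ⟨hGna j hj, i, hi, not_lt.1 hle⟩)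
  have hAadd : ∀ a b, a ≤ b → A b = A a + ∑ i ∈ Ico a b, (x (ξ i) - y (η i)) := by
    intro a b hab
    induction b, hab using Nat.le_induction with
    | base => simp
    | succ b hab ih => rw [hstep, ih, sum_Ico_succ_top hab]; ring
  have hgap : ∀ j ∈ G, x (ξ (p (j + 1))) + x (ξ (p j))
      + ∑ i ∈ Ioo (p j) (p (j + 1)), x (ξ i) - ∑ i ∈ Ico (p j) (p (j + 1)), y (η i) ≤ M := by
    intro j _
    have hlt : p j < p (j + 1) := hmono (Nat.lt_succ_self j)
    have h1 := hM (p (j + 1))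
    rw [hAadd _ _ hlt.le, sum_sub_distrib, ← Ioo_insert_left hlt,
      sum_insert (by simp : p j ∉ Ioo (p j) (p (j + 1)))] at h1
    rw [← Ioo_insert_left hlt]
    linarith [hA (p j)]
  have hsum := sum_le_sum hgap
  rw [sum_const, hGcard, nsmul_eq_mul, sum_sub_distrib, sum_add_distrib, sum_add_distrib] at hsum
  have hpinj : ∀ j j', p j = p j' → j = j' := fun j j' => hmono.injective.eq_iff.1
  have hnext : ∑ i ∈ range (na - L), x (na - i) ≤ ∑ j ∈ G, x (ξ (p (j + 1))) := by
    have hinj : Set.InjOn (fun j => ξ (p (j + 1))) (G : Set ℕ) := by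
      intro j hj j' hj' h
      have mem : ∀ j ∈ G, p (j + 1) ∈ Ico (p 0 + 1) (p 0 + 1 + n) := by
        intro j hj
        have h1 := hmono (Nat.succ_pos j)
        have h2 := hmono.monotone (show j + 1 ≤ na from hGna j hj)
        simp only [mem_Ico, Nat.succ_eq_add_one] at h1 ⊢
        omega
      have := hpinj _ _ (hξinj (p 0 + 1) (mem_coe.2 (mem j hj)) (mem_coe.2 (mem j' hj')) h)
      omega
    rw [← hGcard, ← card_image_of_injOn hinj, ← sum_image hinj]
    refine sum_range_card_le_sum na (fun i j h1 h2 h3 => hx i j h1 h2 (h3.trans hna)) ?_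
    exact image_subset_iff.2 fun j _ => mem_Icc.2 ⟨(mem_Icc.1 (hξ _)).1, hbig _⟩
  have hstart : ∑ i ∈ range (na - L), x (na - i) ≤ ∑ j ∈ G, x (ξ (p j)) := by
    have hinj : Set.InjOn (fun j => ξ (p j)) (G : Set ℕ) := by
      intro j hj j' hj' h
      have mem : ∀ j ∈ G, p j ∈ Ico (p 0) (p 0 + n) := fun j hj =>
        hwindow j (hGna j hj) _ (left_mem_Ico.2 (hmono (Nat.lt_succ_self j)))
      exact hpinj _ _ (hξinj (p 0) (mem_coe.2 (mem j hj)) (mem_coe.2 (mem j' hj')) h)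
    rw [← hGcard, ← card_image_of_injOn hinj, ← sum_image hinj]
    refine sum_range_card_le_sum na (fun i j h1 h2 h3 => hx i j h1 h2 (h3.trans hna)) ?_
    exact image_subset_iff.2 fun j _ => mem_Icc.2 ⟨(mem_Icc.1 (hξ _)).1, hbig _⟩
  have hdisjIco : (G : Set ℕ).PairwiseDisjoint fun j => Ico (p j) (p (j + 1)) :=
    fun j _ j' _ hne => disjoint_left.2 fun i hi hi' => hne (hdisj j j' i hi hi')
  have hdisjIoo : (G : Set ℕ).PairwiseDisjoint fun j => Ioo (p j) (p (j + 1)) :=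
    hdisjIco.mono fun j => Ioo_subset_Ico_self
  set small := G.biUnion fun j => Ioo (p j) (p (j + 1)) with hsmalldef
  set all := G.biUnion fun j => Ico (p j) (p (j + 1)) with halldef
  have hallwin : all ⊆ Ico (p 0) (p 0 + n) :=
    biUnion_subset.2 fun j hj i hi => hwindow j (hGna j hj) i hi
  have hsmallall : small ⊆ all := biUnion_mono fun j _ => Ioo_subset_Ico_self
  have hsinj : Set.InjOn ξ (small : Set ℕ) :=
    (hξinj (p 0)).mono (coe_subset.2 (hsmallall.trans hallwin))
  have hainj : Set.InjOn η (all : Set ℕ) := (hηinj (p 0)).mono (coe_subset.2 hallwin)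
  have hsmallmaps : small.image ξ ⊆ Ioc na n := by
    refine image_subset_iff.2 fun i hi => ?_
    obtain ⟨j, _, hij⟩ := mem_biUnion.1 hi
    rw [mem_Ioo] at hij
    exact mem_Ioc.2 ⟨hsmall j i hij.1 hij.2, (mem_Icc.1 (hξ i)).2⟩
  have hmid : ∑ i ∈ range #small, x (n - i)
      ≤ ∑ j ∈ G, ∑ i ∈ Ioo (p j) (p (j + 1)), x (ξ i) := by
    rw [← sum_biUnion hdisjIoo, ← hsmalldef, ← card_image_of_injOn hsinj, ← sum_image hsinj]
    exact sum_range_card_le_sum n hx (hsmallmaps.trans fun i hi => by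
      simp only [mem_Ioc, mem_Icc] at hi ⊢; omega)
  have hcard : #all = (na - L) + #small := by
    rw [halldef, hsmalldef, card_biUnion hdisjIco, card_biUnion hdisjIoo, ← hGcard, card_eq_sum_ones,
      ← sum_add_distrib]
    refine sum_congr rfl fun j _ => ?_
    have := hmono (Nat.lt_succ_self j)
    simp only [Nat.card_Ico, Nat.card_Ioo, Nat.succ_eq_add_one] at this ⊢
    omega
  have hout : ∑ j ∈ G, ∑ i ∈ Ico (p j) (p (j + 1)), y (η i)
      ≤ ∑ i ∈ range (na - L), y (L + 1 + i) + ∑ i ∈ range #small, y (na + 1 + i) := by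
    have hle : ∑ i ∈ all.image η, y i ≤ _ := sum_le_sum_range_card L hy
      (image_subset_iff.2 fun i hi => by
        obtain ⟨j, hj, hij⟩ := mem_biUnion.1 hi
        exact mem_Ioc.2 ⟨hGη j hj i hij, (mem_Icc.1 (hη i)).2⟩)
    rw [sum_image hainj, card_image_of_injOn hainj, hcard, sum_range_add, halldef,
      sum_biUnion hdisjIco] at hle
    refine hle.trans_eq (congrArg _ (sum_congr rfl fun i _ => ?_))
    congr 1
    omega
  refine ⟨#small, ?_, ?_⟩
  · have := card_le_card hsmallmaps
    rwa [card_image_of_injOn hsinj, Nat.card_Ioc] at this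
  · rw [sum_sub_distrib]
    linarith

/-- **Lower bound for the alternating stock size problem (barrier lower bound).**
With the barrier notation (inputs `x, y` given 1-indexed; `a'_i = x (nb+i)`,
`w'_i = y (nb+i)`, `v_j = x (n+1-j)`, `w_j = y (na+j)`, crossing index `h`),
if `n_a > n_b` then for every `s ∈ {1,…,n_a−n_b}` every feasible alternating
ordering attains, at some prefix, a value at least
`(2·Σ_{i=s}^{na−nb} a'_i − Σ_{i=s}^{na−nb} w'_i + Σ_{i=1}^h (v_i − w_i)) / (na−nb−s+1)`;
hence `S*` is at least this quantity. -/
theorem alternating_stock_size_lower_bound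
    (n : ℕ) (hn : 1 ≤ n) (x y : ℕ → ℝ)
    (hxpos : ∀ i, 1 ≤ i → i ≤ n → 0 < x i)
    (hypos : ∀ i, 1 ≤ i → i ≤ n → 0 < y i)
    (hxsort : ∀ i j, 1 ≤ i → i ≤ j → j ≤ n → x j ≤ x i)
    (hysort : ∀ i j, 1 ≤ i → i ≤ j → j ≤ n → y j ≤ y i)
    (hsum : ∑ i ∈ Finset.Icc 1 n, x i = ∑ i ∈ Finset.Icc 1 n, y i)
    (μ C : ℝ) (hμ : μ = max (x 1) (y 1)) (hC : C ≤ μ)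
    (na nb k : ℕ) (hnan : na ≤ n) (hnbna : nb < na) (hk : k = n - na)
    (hna : ∀ i, 1 ≤ i → i ≤ n → (C ≤ x i ↔ i ≤ na))
    (hnb : ∀ i, 1 ≤ i → i ≤ n → (C ≤ y i ↔ i ≤ nb))
    (h : ℕ) (hhk : h ≤ k)
    (hh1 : ∀ j, 1 ≤ j → j ≤ h → x (n + 1 - j) < y (na + j))
    (hh2 : ∀ j, h < j → j ≤ k → y (na + j) ≤ x (n + 1 - j))
    (s : ℕ) (hs1 : 1 ≤ s) (hs2 : s ≤ na - nb)
    (σ ν : Equiv.Perm (Fin n))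
    (hfeas : ∀ t : Fin n, 0 ≤ ∑ i ∈ Finset.univ.filter (· ≤ t),
        (x ((σ i : ℕ) + 1) - y ((ν i : ℕ) + 1))) :
    ∃ t : Fin n,
      (2 * ∑ i ∈ Finset.Icc s (na - nb), x (nb + i)
        - ∑ i ∈ Finset.Icc s (na - nb), y (nb + i)
        + ∑ i ∈ Finset.Icc 1 h, (x (n + 1 - i) - y (na + i)))
        / ((na : ℝ) - (nb : ℝ) - (s : ℝ) + 1)
      ≤ (∑ i ∈ Finset.univ.filter (· ≤ t), x ((σ i : ℕ) + 1))
        - ∑ i ∈ Finset.univ.filter (· < t), y ((ν i : ℕ) + 1) := by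
  have : NeZero n := ⟨by omega⟩
  let ξ : ℕ → ℕ := fun i => σ (Fin.ofNat n i) + 1
  let η : ℕ → ℕ := fun i => ν (Fin.ofNat n i) + 1
  let A : ℕ → ℝ := fun t => ∑ i ∈ Finset.range t, (x (ξ i) - y (η i))
  have hmem : ∀ (τ : Equiv.Perm (Fin n)) (i : ℕ), (τ (Fin.ofNat n i) : ℕ) + 1 ∈ Finset.Icc 1 n :=
    fun τ i => Finset.mem_Icc.2 ⟨by omega, (τ _).isLt⟩
  have hmod : ∀ (τ : Equiv.Perm (Fin n)) (i j : ℕ),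
      (τ (Fin.ofNat n i) : ℕ) + 1 = τ (Fin.ofNat n j) + 1 ↔ i ≡ j [MOD n] := by
    intro τ i j
    rw [Nat.add_right_cancel_iff, Fin.val_inj, τ.injective.eq_iff, Fin.ext_iff]
    rfl
  have hofNat : ∀ i : Fin n, Fin.ofNat n (i : ℕ) = i := fun i =>
    Fin.ext (Nat.mod_eq_of_lt i.isLt)
  have hprefix : ∀ (f : ℕ → ℝ) (g : Fin n → ℝ), (∀ i : Fin n, f i = g i) → ∀ t : Fin n,
      ∑ i ∈ Finset.univ.filter (· < t), g i = ∑ i ∈ Finset.range t, f i := by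
    intro f g hfg t
    refine Finset.sum_bij (fun i _ => (i : ℕ)) ?_ ?_ ?_ ?_
    · intro i hi
      simpa using hi
    · intro i _ j _ hij
      exact Fin.ext hij
    · intro j hj
      rw [Finset.mem_range] at hj
      exact ⟨⟨j, hj.trans t.isLt⟩, Finset.mem_filter.2 ⟨Finset.mem_univ _, hj⟩, rfl⟩
    · intro i _
      exact (hfg i).symm
  have hle : ∀ t : Fin n, Finset.univ.filter (· ≤ t) = insert t (Finset.univ.filter (· < t)) := by
    intro t
    ext i
    simp only [Finset.mem_filter, Finset.mem_univ, true_and, Finset.mem_insert]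
    exact le_iff_eq_or_lt
  have hterm : ∀ i : Fin n, x (ξ i) - y (η i) = x ((σ i : ℕ) + 1) - y ((ν i : ℕ) + 1) :=
    fun i => by simp only [ξ, η, hofNat]
  have hAn : A n = 0 := by
    have htotal : ∀ (f : ℕ → ℝ) (τ : Equiv.Perm (Fin n)),
        ∑ i : Fin n, f ((τ i : ℕ) + 1) = ∑ i ∈ Finset.Icc 1 n, f i := by
      intro f τ
      rw [Equiv.sum_comp τ fun i : Fin n => f ((i : ℕ) + 1),
        Fin.sum_univ_eq_sum_range fun i => f (i + 1), Finset.range_eq_Ico,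
        Finset.sum_Ico_add' f 0 n 1]
      rfl
    change ∑ i ∈ Finset.range n, (x (ξ i) - y (η i)) = 0
    rw [← Fin.sum_univ_eq_sum_range fun i => x (ξ i) - y (η i), Finset.sum_congr rfl fun i _ => hterm i,
      Finset.sum_sub_distrib, htotal x σ, htotal y ν, hsum, sub_self]
  have hAstep : ∀ i, A (i + 1) = A i + (x (ξ i) - y (η i)) := fun i => Finset.sum_range_succ _ _
  have hξn : ∀ i, ξ (i + n) = ξ i := fun i => (hmod σ _ _).2 (by simp [Nat.ModEq])
  have hηn : ∀ i, η (i + n) = η i := fun i => (hmod ν _ _).2 (by simp [Nat.ModEq])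
  have hAper : Function.Periodic A n := by
    intro i
    induction i with
    | zero => rw [zero_add, hAn]; simp [A]
    | succ i ih => rw [Nat.add_right_comm, hAstep, hAstep, ih, hξn, hηn]
  have hAnonneg : ∀ i, 0 ≤ A i := by
    intro i
    rw [← hAper.map_mod_nat i]
    rcases Nat.eq_zero_or_pos (i % n) with h0 | h0
    · simp [h0, A]
    · have hlt := Nat.mod_lt i (show n > 0 by omega)
      have := hfeas ⟨i % n - 1, by omega⟩
      rw [hle, Finset.sum_insert (by simp), hprefix (fun i => x (ξ i) - y (η i)) _ hterm, ← hterm, add_comm,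
        ← Finset.sum_range_succ] at this
      rwa [show ((⟨i % n - 1, by omega⟩ : Fin n) : ℕ) + 1 = i % n from Nat.sub_add_cancel h0] at this
  obtain ⟨t, ht⟩ := Finite.exists_max fun t : Fin n => A t + x (ξ t)
  have hM : ∀ i, A i + x (ξ i) ≤ A t + x (ξ t) := by
    have hper : Function.Periodic (fun i => A i + x (ξ i)) n := fun i => by
      simp only [hAper i, hξn]
    intro i
    rw [← hper.map_mod_nat i]
    exact ht ⟨i % n, Nat.mod_lt _ (by omega)⟩
  obtain ⟨r, hr, hbound⟩ := exists_periodic_stock_bound hnan (show nb + s - 1 < na by omega)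
    hxsort hysort (hmem σ) (hmem ν) (hmod σ) (hmod ν) hAnonneg hAstep hM
  refine ⟨t, ?_⟩
  have hpeak : (∑ i ∈ Finset.univ.filter (· ≤ t), x ((σ i : ℕ) + 1))
      - ∑ i ∈ Finset.univ.filter (· < t), y ((ν i : ℕ) + 1) = A t + x (ξ t) := by
    rw [hle, Finset.sum_insert (by simp), add_sub_assoc, ← Finset.sum_sub_distrib,
      hprefix (fun i => x (ξ i) - y (η i)) _ hterm, add_comm]
    simp only [A, ξ, hofNat]
  have hlen : na - (nb + s - 1) = na - nb + 1 - s := by omega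
  rw [hlen] at hbound
  have hcast : ((na - nb + 1 - s : ℕ) : ℝ) = (na : ℝ) - nb - s + 1 := by
    rw [Nat.cast_sub (by omega), Nat.cast_add, Nat.cast_sub hnbna.le]
    push_cast
    ring
  have hIcc : ∀ (f : ℕ → ℝ) (a b : ℕ), ∑ i ∈ Finset.Icc a b, f i
      = ∑ i ∈ Finset.range (b + 1 - a), f (a + i) := fun f a b => by
    rw [← Finset.sum_Ico_eq_sum_range]
    rfl
  have hxbig : ∑ i ∈ Finset.Icc s (na - nb), x (nb + i)
      = ∑ i ∈ Finset.range (na - nb + 1 - s), x (na - i) := by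
    rw [hIcc, ← Finset.sum_range_reflect]
    refine Finset.sum_congr rfl fun i hi => ?_
    rw [Finset.mem_range] at hi
    congr 1
    omega
  have hybig : ∑ i ∈ Finset.Icc s (na - nb), y (nb + i)
      = ∑ i ∈ Finset.range (na - nb + 1 - s), y (nb + s - 1 + 1 + i) := by
    rw [hIcc]
    exact Finset.sum_congr rfl fun i _ => by congr 1; omega
  have hcross : ∑ i ∈ Finset.Icc 1 h, (x (n + 1 - i) - y (na + i))
      ≤ ∑ i ∈ Finset.range r, (x (n - i) - y (na + 1 + i)) := by
    have hreindex : ∀ i, x (n + 1 - (1 + i)) - y (na + (1 + i)) = x (n - i) - y (na + 1 + i) :=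
      fun i => by
        rw [show n + 1 - (1 + i) = n - i by omega, show na + (1 + i) = na + 1 + i by omega]
    rw [hIcc, Nat.add_sub_cancel, Finset.sum_congr rfl fun i _ => hreindex i]
    refine sum_range_le_of_sign_change hr (fun i hi => ?_) fun i hi hi' => ?_
    · rw [← hreindex]
      exact sub_neg.2 (hh1 _ (by omega) (by omega))
    · rw [← hreindex]
      exact sub_nonneg.2 (hh2 _ (by omega) (by omega))
  have hpos : (0 : ℝ) < (na : ℝ) - nb - s + 1 := by
    rw [← hcast, Nat.cast_pos]
    omega
  rw [hpeak, div_le_iff₀ hpos, hxbig, hybig, ← hcast, mul_comm (A t + x (ξ t))]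
  linarith
end

section
/- (LP rounding theorem for the gasoline problem.) Let x_1 ≥ x_2 ≥ … ≥ x_n be positive reals and let y_1, …, y_n be nonnegative reals. Suppose Z = (z_{ij}) is an n×n doubly stochastic matrix and α, β are reals such that for every k ∈ {1,…,n}: Σ_{j=1}^{k} Σ_{i=1}^{n} z_{ij}·x_i − Σ_{j=1}^{k−1} y_j ≤ β and Σ_{j=1}^{k} Σ_{i=1}^{n} z_{ij}·x_i − Σ_{j=1}^{k} y_j ≥ α. Then there exists a permutation π of {1,…,n} such that for every k ∈ {1,…,n}: Σ_{j=1}^{k} x_{π(j)} − Σ_{j=1}^{k−1} y_j ≤ β + x_1 and Σ_{j=1}^{k} x_{π(j)} − Σ_{j=1}^{k} y_j ≥ α. In particular, applying this to an optimal fractional solution yields a permutation of value at most (β − α) + x_1 ≤ 2·OPT, where OPT is the value of the optimal permutation. -/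
open Finset Filter Topology

/-- Among all doubly stochastic matrices with given weighted column sums there is one that, in
every column, leaves nothing for later columns in the rows strictly between two rows it uses. -/
lemma exists_doublyStochastic_concentrated {n : ℕ} (x : Fin n → ℝ) (hx : StrictAnti x)
    (z : Fin n → Fin n → ℝ) (hz : ∀ i j, 0 ≤ z i j)
    (hzrow : ∀ i, ∑ j, z i j = 1) (hzcol : ∀ j, ∑ i, z i j = 1) :
    ∃ w : Fin n → Fin n → ℝ, (∀ i j, 0 ≤ w i j) ∧ (∀ i, ∑ j, w i j = 1) ∧
      (∀ j, ∑ i, w i j = 1) ∧ (∀ j, ∑ i, w i j * x i = ∑ i, z i j * x i) ∧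
      ∀ a t b k l, a < t → t < b → k < l → 0 < w a k → 0 < w b k → w t l = 0 := by
  let K : Set (Fin n → Fin n → ℝ) := {w | (∀ i j, 0 ≤ w i j) ∧ (∀ i, ∑ j, w i j = 1) ∧
      (∀ j, ∑ i, w i j = 1) ∧ (∀ j, ∑ i, w i j * x i = ∑ i, z i j * x i)}
  have hKc : IsCompact K := by
    refine (isCompact_Icc (a := (0 : Fin n → Fin n → ℝ)) (b := 1)).of_isClosed_subset ?_ ?_
    · simp only [K, Set.ofPred_and, Set.ofPred_forall]
      refine IsClosed.inter ?_ (IsClosed.inter ?_ (IsClosed.inter ?_ ?_))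
      · exact isClosed_iInter fun i => isClosed_iInter fun j =>
          isClosed_le continuous_const (by fun_prop)
      all_goals exact isClosed_iInter fun i => isClosed_eq (by fun_prop) continuous_const
    · rintro w ⟨h0, h1, -, -⟩
      refine ⟨fun i j => h0 i j, fun i j => ?_⟩
      rw [Pi.one_apply, Pi.one_apply, ← h1 i]
      exact single_le_sum (fun j _ => h0 i j) (mem_univ j)
  obtain ⟨w, hwK, hmax⟩ := hKc.exists_isMaxOn ⟨z, hz, hzrow, hzcol, fun _ => rfl⟩
    (f := fun w => ∑ i, ∑ j, w i j * ((x i) ^ 2 * (j : ℝ))) (by fun_prop)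
  obtain ⟨h0, h1, h2, h3⟩ := hwK
  refine ⟨w, h0, h1, h2, h3, fun a t b k l hat htb hkl ha hb => ?_⟩
  by_contra hne
  have ht : 0 < w t l := lt_of_le_of_ne (h0 t l) (Ne.symm hne)
  have hxa := hx hat
  have hxb := hx htb
  let u : Fin n → ℝ := fun i => (Pi.single t (x a - x b) : Fin n → ℝ) i
    - (Pi.single a (x t - x b) : Fin n → ℝ) i - (Pi.single b (x a - x t) : Fin n → ℝ) i
  let d : Fin n → ℝ := fun j => (Pi.single k 1 : Fin n → ℝ) j - (Pi.single l 1 : Fin n → ℝ) j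
  have hu : ∀ f : Fin n → ℝ, ∑ i, u i * f i
      = (x a - x b) * f t - (x t - x b) * f a - (x a - x t) * f b := by
    intro f
    simp [u, sub_mul, sum_sub_distrib, Pi.single_apply]
  have hd : ∀ f : Fin n → ℝ, ∑ j, d j * f j = f k - f l := by
    intro f
    simp [d, sub_mul, sum_sub_distrib, Pi.single_apply]
  have hcase : ∀ i j, 0 < w i j ∨ 0 ≤ u i * d j := by
    intro i j
    have hta := hat.ne'
    have htb' := htb.ne
    have hab := (hat.trans htb).ne
    have hkl' := hkl.ne
    by_cases hjk : j = k
    · subst hjk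
      by_cases hia : i = a
      · exact Or.inl (hia ▸ ha)
      by_cases hib : i = b
      · exact Or.inl (hib ▸ hb)
      right
      by_cases hit : i = t
      · subst hit; simp [u, d, hia, hib, hkl']; linarith
      · simp [u, hia, hib, hit]
    by_cases hjl : j = l
    · subst hjl
      by_cases hit : i = t
      · exact Or.inl (hit ▸ ht)
      right
      by_cases hia : i = a
      · subst hia; simp [u, d, hit, hab, hjk]; linarith
      by_cases hib : i = b
      · subst hib; simp [u, d, hit, hia, hjk]; linarith
      · simp [u, hia, hib, hit]
    · right; simp [d, hjk, hjl]
  have hev : ∀ᶠ ε : ℝ in 𝓝[>] 0, ∀ i j, 0 ≤ w i j + ε * (u i * d j) := by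
    refine eventually_all.2 fun i => eventually_all.2 fun j => ?_
    rcases hcase i j with h | h
    · have hc : Tendsto (fun ε : ℝ => w i j + ε * (u i * d j)) (𝓝[>] 0) (𝓝 (w i j)) := by
        have : Continuous fun ε : ℝ => w i j + ε * (u i * d j) := by fun_prop
        simpa using (this.tendsto 0).mono_left nhdsWithin_le_nhds
      exact (hc.eventually (lt_mem_nhds h)).mono fun _ => le_of_lt
    · filter_upwards [self_mem_nhdsWithin] with ε hε
      exact add_nonneg (h0 i j) (mul_nonneg (le_of_lt hε) h)
  obtain ⟨ε, hε, hεpos⟩ := (hev.and self_mem_nhdsWithin).exists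
  have hu0 : ∑ i, u i = 0 := by have := hu 1; simp at this; linarith
  have hd0 : ∑ j, d j = 0 := by have := hd 1; simp at this; linarith
  have hux : ∑ i, u i * x i = 0 := by rw [hu]; ring
  have hmem : (fun i j => w i j + ε * (u i * d j)) ∈ K := by
    refine ⟨hε, fun i => ?_, fun j => ?_, fun j => ?_⟩
    · rw [sum_add_distrib, h1, ← mul_sum, ← mul_sum, hd0]; ring
    · rw [sum_add_distrib, h2, ← mul_sum, ← sum_mul, hu0]; ring
    · have : ∀ i, (w i j + ε * (u i * d j)) * x i = w i j * x i + ε * d j * (u i * x i) := by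
        intro i; ring
      simp_rw [this]
      rw [sum_add_distrib, h3, ← mul_sum, hux]; ring
  have hle := hmax hmem
  have hcost : ∑ i, ∑ j, (w i j + ε * (u i * d j)) * ((x i) ^ 2 * (j : ℝ))
      = ∑ i, ∑ j, w i j * ((x i) ^ 2 * (j : ℝ))
        + ε * ((∑ i, u i * x i ^ 2) * ∑ j, d j * (j : ℝ)) := by
    rw [sum_mul_sum, mul_sum, ← sum_add_distrib]
    refine sum_congr rfl fun i _ => ?_
    rw [mul_sum, ← sum_add_distrib]
    exact sum_congr rfl fun j _ => by ring
  simp only [Set.mem_ofPred_eq] at hle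
  rw [hcost, hu, hd fun j => (j : ℝ)] at hle
  have hkl' : ((k : ℕ) : ℝ) < (l : ℕ) := by exact_mod_cast hkl
  have hpos : 0 < ε * (((x a - x t) * (x t - x b) * (x a - x b)) * ((l : ℕ) - (k : ℕ) : ℝ)) :=
    mul_pos hεpos (mul_pos (mul_pos (mul_pos (by linarith) (by linarith)) (by linarith))
      (by linarith))
  nlinarith [hle, hpos]

lemma sum_filter_val_lt_succ {n : ℕ} {M : Type*} [AddCommMonoid M] (f : Fin n → M) (s : Fin n) :
    ∑ i with i.val < s.val + 1, f i = ∑ i with i.val < s.val, f i + f s := by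
  have : univ.filter (fun i : Fin n => i.val < s.val + 1)
      = insert s (univ.filter fun i : Fin n => i.val < s.val) := by
    ext i
    simp only [mem_filter, mem_univ, true_and, mem_insert, Fin.ext_iff]
    omega
  rw [this, sum_insert (by simp), add_comm]

/-- If a doubly stochastic matrix is concentrated in the sense of
`exists_doublyStochastic_concentrated`, rounding up its corner sums yields the corner sums of a
permutation matrix. -/
lemma exists_perm_ceil_cornerSum {n : ℕ} (w : Fin n → Fin n → ℝ) (h0 : ∀ i j, 0 ≤ w i j)
    (hrow : ∀ i, ∑ j, w i j = 1) (hcol : ∀ j, ∑ i, w i j = 1)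
    (hw : ∀ a t b k l, a < t → t < b → k < l → 0 < w a k → 0 < w b k → w t l = 0) :
    ∃ π : Equiv.Perm (Fin n), ∀ s k : ℕ, s ≤ n → k ≤ n →
      ⌈∑ j with j.val < k, ∑ i with i.val < s, w i j⌉
        = ∑ j with j.val < k, if (π j).val < s then (1 : ℤ) else 0 := by
  let C : ℕ → ℕ → ℝ := fun s k => ∑ j with j.val < k, ∑ i with i.val < s, w i j
  let e : ℕ → Fin n → ℝ := fun s k => ∑ i with i.val < s, w i k
  let D : ℕ → Fin n → ℤ := fun s k => ⌈C s (k.val + 1)⌉ - ⌈C s k.val⌉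
  have hCk : ∀ s (k : Fin n), C s (k.val + 1) = C s k.val + e s k := fun s k =>
    sum_filter_val_lt_succ _ k
  have hCs : ∀ (s : Fin n) k, C (s.val + 1) k = C s.val k + ∑ j with j.val < k, w s j := by
    intro s k
    simp only [C, sum_filter_val_lt_succ, sum_add_distrib]
  have hes : ∀ (s : Fin n) k, e (s.val + 1) k = e s.val k + w s k := fun s k =>
    sum_filter_val_lt_succ _ s
  have he0 : ∀ s k, 0 ≤ e s k := fun s k => sum_nonneg fun i _ => h0 i k
  have he1 : ∀ s k, e s k ≤ 1 := fun s k => by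
    rw [← hcol k]
    exact sum_le_sum_of_subset_of_nonneg (filter_subset _ _) fun i _ _ => h0 i k
  have hen : ∀ k, e n k = 1 := fun k => by
    rw [← hcol k]; simp [e]
  have hD0 : ∀ s k, 0 ≤ D s k := fun s k => by
    have : ⌈C s k.val⌉ ≤ ⌈C s (k.val + 1)⌉ := Int.ceil_mono (by linarith [hCk s k, he0 s k])
    simp only [D]; omega
  have hD1 : ∀ s k, D s k ≤ 1 := fun s k => by
    have : ⌈C s (k.val + 1)⌉ ≤ ⌈C s k.val + 1⌉ := Int.ceil_mono (by linarith [hCk s k, he1 s k])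
    rw [Int.ceil_add_one] at this
    simp only [D]; omega
  have hDe0 : ∀ s k, e s k = 0 → D s k = 0 := fun s k h => by simp [D, hCk, h]
  have hDe1 : ∀ s k, e s k = 1 → D s k = 1 := fun s k h => by simp [D, hCk, h]
  have hmono : ∀ (s k : Fin n), D s.val k ≤ D (s.val + 1) k := by
    intro s k
    rcases (he0 s.val k).eq_or_lt with h | hs
    · rw [hDe0 _ _ h.symm]; exact hD0 _ _
    rcases (he1 (s.val + 1) k).eq_or_lt with h | hs1
    · rw [hDe1 _ _ h]; exact hD1 _ _
    obtain ⟨a, ha, hak⟩ := exists_lt_of_sum_lt (f := fun _ => (0 : ℝ)) (g := fun i => w i k)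
      (s := univ.filter fun i : Fin n => i.val < s.val) (by rw [sum_const_zero]; exact hs)
    have hsplit := sum_filter_add_sum_filter_not univ (fun i : Fin n => i.val < s.val + 1)
      fun i => w i k
    rw [hcol] at hsplit
    obtain ⟨b, hb, hbk⟩ := exists_lt_of_sum_lt (f := fun _ => (0 : ℝ)) (g := fun i => w i k)
      (s := univ.filter fun i : Fin n => ¬ i.val < s.val + 1)
      (by simp only [e] at hs1; simp only [sum_const_zero]; linarith)
    simp only [mem_filter, mem_univ, true_and] at ha hb
    have hrow1 : ∑ j with j.val < k.val + 1, w s j = 1 := by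
      rw [← hrow s, sum_filter]
      refine sum_congr rfl fun j _ => ?_
      split_ifs with hj
      · rfl
      · exact (hw a s b k j (Fin.lt_def.2 ha) (Fin.lt_def.2 (by omega))
          (Fin.lt_def.2 (by omega)) hak hbk).symm
    have h1 : C (s.val + 1) (k.val + 1) = C s.val (k.val + 1) + 1 := by rw [hCs, hrow1]
    have h2 : ⌈C (s.val + 1) k.val⌉ ≤ ⌈C s.val k.val + 1⌉ := Int.ceil_mono (by
      linarith [hCk s.val k, hCk (s.val + 1) k, hes s k, h0 s k])
    simp only [D, h1, Int.ceil_add_one] at h2 ⊢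
    omega
  have hjump : ∀ k : Fin n, ∃ p : Fin n, ∀ s ≤ n, D s k = if p.val < s then 1 else 0 := by
    intro k
    have hmon : ∀ s t, s ≤ t → t ≤ n → D s k ≤ D t k := by
      intro s t hst
      induction t, hst using Nat.le_induction with
      | base => exact fun _ => le_rfl
      | succ t _ ih => exact fun ht => (ih (by omega)).trans (hmono ⟨t, ht⟩ k)
    have hex : ∃ s, s ≤ n ∧ D s k = 1 := ⟨n, le_rfl, hDe1 _ _ (hen k)⟩
    classical
    obtain ⟨hqn, hq1⟩ := Nat.find_spec hex
    have hq0 : Nat.find hex ≠ 0 := fun h => by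
      rw [h, hDe0 0 k (by simp [e])] at hq1
      exact zero_ne_one hq1
    refine ⟨⟨Nat.find hex - 1, by omega⟩, fun s hs => ?_⟩
    have hs0 := hD0 s k
    have hs1 := hD1 s k
    split_ifs with h
    · have := hmon (Nat.find hex) s (by simp only at h; omega) hs
      omega
    · have := Nat.find_min hex (m := s) (by simp only at h; omega)
      have : D s k ≠ 1 := fun h' => this ⟨hs, h'⟩
      omega
  choose p hp using hjump
  have hceil : ∀ s k : ℕ, s ≤ n → k ≤ n →
      ⌈C s k⌉ = ∑ j with j.val < k, if (p j).val < s then (1 : ℤ) else 0 := by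
    intro s k hs
    induction k with
    | zero => intro _; simp [C]
    | succ k ih =>
      intro hk
      have h := sum_filter_val_lt_succ (fun j => if (p j).val < s then (1 : ℤ) else 0) ⟨k, hk⟩
      simp only at h
      rw [h, ← ih (by omega), ← hp ⟨k, hk⟩ s hs]
      simp [D]
  have hcount : ∀ s ≤ n, (∑ j, if (p j).val < s then (1 : ℤ) else 0) = s := by
    intro s hs
    have h := hceil s n hs le_rfl
    have hC : ∀ s ≤ n, C s n = s := by
      intro s
      induction s with
      | zero => intro _; simp [C]
      | succ s ih =>
        intro hs
        have h := hCs ⟨s, hs⟩ n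
        simp only [Fin.is_lt, filter_true, hrow] at h
        rw [h, ih (by omega)]
        push_cast; ring
    rw [hC s hs] at h
    simpa using h.symm
  have hsurj : Function.Surjective p := by
    intro i
    by_contra! hi
    have h1 := hcount i.val i.is_lt.le
    have h2 := hcount (i.val + 1) i.is_lt
    have : (∑ j, if (p j).val < i.val + 1 then (1 : ℤ) else 0)
        = ∑ j, if (p j).val < i.val then (1 : ℤ) else 0 := by
      refine sum_congr rfl fun j _ => if_congr ?_ rfl rfl
      have := Fin.val_ne_of_ne (hi j)
      omega
    push_cast at h2
    omega
  exact ⟨Equiv.ofBijective p (Finite.surjective_iff_bijective.1 hsurj), hceil⟩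

lemma exists_nonneg_sum_tail_eq {n : ℕ} (hn : 0 < n) (x : Fin n → ℝ) (hx : Antitone x)
    (hx0 : ∀ i, 0 ≤ x i) :
    ∃ δ : Fin n → ℝ, (∀ s, 0 ≤ δ s) ∧ (∑ s, δ s = x ⟨0, hn⟩) ∧
      ∀ i, x i = ∑ s, if i.val < s.val + 1 then δ s else 0 := by
  let X : ℕ → ℝ := fun m => if h : m < n then x ⟨m, h⟩ else 0
  have htail : ∀ i : Fin n,
      x i = ∑ s : Fin n, if i.val < s.val + 1 then X s.val - X (s.val + 1) else 0 := by
    intro i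
    rw [Fin.sum_univ_eq_sum_range
      (fun s => if i.val < s + 1 then X s - X (s + 1) else 0) n, ← sum_filter]
    have : (range n).filter (fun s => i.val < s + 1) = Ico i.val n := by
      ext s; simp only [mem_filter, mem_range, mem_Ico]; omega
    rw [this, ← neg_inj, ← sum_neg_distrib]
    simp only [neg_sub]
    rw [sum_Ico_sub X i.is_lt.le]
    simp [X]
  refine ⟨fun s => X s.val - X (s.val + 1), fun s => ?_, ?_, htail⟩
  · simp only [X, s.is_lt, dite_true]
    split_ifs with h
    · exact sub_nonneg.2 (hx (Fin.le_def.2 (by simp)))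
    · simpa using hx0 s
  · rw [htail ⟨0, hn⟩]; simp

lemma exists_perm_prefixSum_of_strictAnti {n : ℕ} (hn : 0 < n) (x : Fin n → ℝ)
    (hx : StrictAnti x) (hx0 : ∀ i, 0 ≤ x i)
    (z : Fin n → Fin n → ℝ) (hz : ∀ i j, 0 ≤ z i j)
    (hzrow : ∀ i, ∑ j, z i j = 1) (hzcol : ∀ j, ∑ i, z i j = 1) :
    ∃ π : Equiv.Perm (Fin n), ∀ k : Fin n,
      ∑ j with j ≤ k, ∑ i, z i j * x i ≤ ∑ j with j ≤ k, x (π j) ∧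
      ∑ j with j ≤ k, x (π j) ≤ ∑ j with j ≤ k, ∑ i, z i j * x i + x ⟨0, hn⟩ := by
  obtain ⟨w, h0, hrow, hcol, hmom, hw⟩ :=
    exists_doublyStochastic_concentrated x hx z hz hzrow hzcol
  obtain ⟨π, hπ⟩ := exists_perm_ceil_cornerSum w h0 hrow hcol hw
  obtain ⟨δ, hδ0, hδsum, hδ⟩ := exists_nonneg_sum_tail_eq hn x hx.antitone hx0
  refine ⟨π, fun k => ?_⟩
  let C : Fin n → ℝ := fun s => ∑ j with j.val < k.val + 1, ∑ i with i.val < s.val + 1, w i j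
  have hfilter : univ.filter (fun j : Fin n => j ≤ k)
      = univ.filter fun j : Fin n => j.val < k.val + 1 := by
    ext j; simp only [mem_filter, mem_univ, true_and, Fin.le_def]; omega
  have hF : ∑ j with j ≤ k, ∑ i, z i j * x i = ∑ s, δ s * C s := by
    simp_rw [← hmom, C, mul_sum]
    rw [hfilter]
    conv_rhs => rw [sum_comm]
    refine sum_congr rfl fun j _ => ?_
    simp_rw [sum_filter]
    conv_rhs => rw [sum_comm]
    refine sum_congr rfl fun i _ => ?_
    rw [hδ i, mul_sum]
    exact sum_congr rfl fun s _ => by split_ifs <;> ring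
  have hP : ∑ j with j ≤ k, x (π j) = ∑ s, δ s * (⌈C s⌉ : ℝ) := by
    have : ∀ s : Fin n, (⌈C s⌉ : ℝ)
        = ∑ j with j.val < k.val + 1, if (π j).val < s.val + 1 then (1 : ℝ) else 0 := by
      intro s
      have := hπ (s.val + 1) (k.val + 1) s.is_lt k.is_lt
      simp only [C, this]
      push_cast
      rfl
    simp_rw [this, mul_sum]
    rw [sum_comm, hfilter]
    refine sum_congr rfl fun j _ => ?_
    rw [hδ (π j)]
    exact sum_congr rfl fun s _ => by split_ifs <;> ring
  rw [hF, hP, ← hδsum, ← sum_add_distrib]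
  refine ⟨sum_le_sum fun s _ => mul_le_mul_of_nonneg_left (Int.le_ceil _) (hδ0 s),
    sum_le_sum fun s _ => ?_⟩
  nlinarith [mul_le_mul_of_nonneg_left (Int.ceil_lt_add_one (C s)).le (hδ0 s)]

/-- Prefix sums of a doubly stochastic average of `x` can be rounded up to prefix sums of a
permutation of `x`, with an error of at most the largest entry. -/
lemma exists_perm_prefixSum {n : ℕ} (hn : 0 < n) (x : Fin n → ℝ)
    (hx : Antitone x) (hx0 : ∀ i, 0 ≤ x i)
    (z : Fin n → Fin n → ℝ) (hz : ∀ i j, 0 ≤ z i j)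
    (hzrow : ∀ i, ∑ j, z i j = 1) (hzcol : ∀ j, ∑ i, z i j = 1) :
    ∃ π : Equiv.Perm (Fin n), ∀ k : Fin n,
      ∑ j with j ≤ k, ∑ i, z i j * x i ≤ ∑ j with j ≤ k, x (π j) ∧
      ∑ j with j ≤ k, x (π j) ≤ ∑ j with j ≤ k, ∑ i, z i j * x i + x ⟨0, hn⟩ := by
  let S : Set (Fin n → ℝ) := {x | ∃ π : Equiv.Perm (Fin n), ∀ k : Fin n,
      ∑ j with j ≤ k, ∑ i, z i j * x i ≤ ∑ j with j ≤ k, x (π j) ∧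
      ∑ j with j ≤ k, x (π j) ≤ ∑ j with j ≤ k, ∑ i, z i j * x i + x ⟨0, hn⟩}
  have hS : IsClosed S := by
    simp only [S, Set.ofPred_exists, Set.ofPred_forall, Set.ofPred_and]
    exact isClosed_iUnion_of_finite fun π => isClosed_iInter fun k =>
      (isClosed_le (by fun_prop) (by fun_prop)).inter (isClosed_le (by fun_prop) (by fun_prop))
  have hlim : Tendsto (fun (ε : ℝ) (i : Fin n) => x i + ε * (n - i.val : ℝ)) (𝓝[>] 0) (𝓝 x) := by
    have : Continuous fun (ε : ℝ) (i : Fin n) => x i + ε * (n - i.val : ℝ) := by fun_prop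
    simpa using (this.tendsto 0).mono_left nhdsWithin_le_nhds
  refine hS.mem_of_tendsto hlim ?_
  filter_upwards [self_mem_nhdsWithin] with ε hε
  have hε : 0 < ε := hε
  refine exists_perm_prefixSum_of_strictAnti hn _ (fun i j hij => ?_) (fun i => ?_)
    z hz hzrow hzcol
  · have h1 := hx hij.le
    have h2 : (i.val : ℝ) < j.val := by exact_mod_cast hij
    have := mul_lt_mul_of_pos_left h2 hε
    linarith
  · have h2 : (i.val : ℝ) ≤ n := by exact_mod_cast i.is_lt.le
    exact add_nonneg (hx0 i) (mul_nonneg hε.le (sub_nonneg.2 h2))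


/-- **LP rounding theorem for the gasoline problem.**
If the doubly stochastic matrix `Z` together with `α, β` satisfies the prefix
constraints of the LP relaxation, then there is a permutation `π` satisfying the
same prefix constraints with `β` replaced by `β + x₁` (and the same `α`). -/
theorem gasoline_lp_rounding
    (n : ℕ) (hn : 0 < n)
    (x : Fin n → ℝ) (hx : Antitone x) (hxpos : ∀ i, 0 < x i)
    (y : Fin n → ℝ) (hy : ∀ i, 0 ≤ y i)
    (z : Fin n → Fin n → ℝ)
    (hz01 : ∀ i j, 0 ≤ z i j ∧ z i j ≤ 1)
    (hzrow : ∀ i, ∑ j, z i j = 1)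
    (hzcol : ∀ j, ∑ i, z i j = 1)
    (α β : ℝ)
    (hβ : ∀ k : Fin n,
      (∑ j ∈ Finset.univ.filter (· ≤ k), ∑ i, z i j * x i)
        - (∑ j ∈ Finset.univ.filter (· < k), y j) ≤ β)
    (hα : ∀ k : Fin n,
      α ≤ (∑ j ∈ Finset.univ.filter (· ≤ k), ∑ i, z i j * x i)
        - (∑ j ∈ Finset.univ.filter (· ≤ k), y j)) :
    ∃ π : Equiv.Perm (Fin n),
      ∀ k : Fin n,
        (∑ j ∈ Finset.univ.filter (· ≤ k), x (π j))
          - (∑ j ∈ Finset.univ.filter (· < k), y j) ≤ β + x ⟨0, hn⟩ ∧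
        α ≤ (∑ j ∈ Finset.univ.filter (· ≤ k), x (π j))
          - (∑ j ∈ Finset.univ.filter (· ≤ k), y j) := by
  obtain ⟨π, hπ⟩ := exists_perm_prefixSum hn x hx (fun i => (hxpos i).le) z
    (fun i j => (hz01 i j).1) hzrow hzcol
  refine ⟨π, fun k => ?_⟩
  obtain ⟨h1, h2⟩ := hπ k
  exact ⟨by linarith [hβ k], by linarith [hα k]⟩
end

section
/- (Rounding for the slated stock size problem.) Let x_1 ≥ … ≥ x_{n_x} and y_1 ≥ … ≥ y_{n_y} be positive reals, let n = n_x + n_y, and let {1,…,n} be partitioned into a set I_x of n_x x-slots and a set I_y of n_y y-slots. Suppose Z^x is an n_x×n_x doubly stochastic matrix (columns indexed by I_x), Z^y is an n_y×n_y doubly stochastic matrix (columns indexed by I_y), and α, β are reals such that for every prefix P = {1,…,p} (0 ≤ p ≤ n): α ≤ Σ_{j∈P∩I_x} Σ_{i=1}^{n_x} z^x_{ij}·x_i − Σ_{j∈P∩I_y} Σ_{i=1}^{n_y} z^y_{ij}·y_i ≤ β. Then there exist a bijection σ from I_x to {1,…,n_x} and a bijection π from I_y to {1,…,n_y} such that for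 every prefix P: α − y_1 ≤ Σ_{j∈P∩I_x} x_{σ(j)} − Σ_{j∈P∩I_y} y_{π(j)} ≤ β + x_1. In particular the resulting integral solution has value at most (β − α) + x_1 + y_1 ≤ 3·OPT. -/
open Finset in
/-- A sum of interlaced gaps `w i - c i` is bounded by the largest value `w 0`. -/
theorem sum_interlaced_gap_le (m : ℕ) (w c : ℕ → ℝ) (M : ℝ) (hM : 0 ≤ M) (hw0 : 0 < m → w 0 ≤ M)
    (hc0 : ∀ i < m, 0 ≤ c i) (hwc : ∀ i, i + 1 < m → w (i + 1) ≤ c i) :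
    ∑ i ∈ range m, (w i - c i) ≤ M := by
  have key : ∀ k, k + 1 ≤ m → ∑ i ∈ range (k + 1), (w i - c i) ≤ M - c k := by
    intro k
    induction k with
    | zero =>
      intro h
      have := hw0 (by omega)
      simp only [zero_add, sum_range_one]
      linarith
    | succ k ih =>
      intro h
      rw [sum_range_succ]
      have h1 := ih (by omega)
      have h2 := hwc k (by omega)
      linarith
  cases m with
  | zero => simpa using hM
  | succ m =>
    have h1 := key m le_rfl
    have h2 := hc0 m (by omega)
    linarith

/-- The sequence obtained from `w` by merging the entries at `i` and `i + 1` and subtracting `a`. -/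
def mergeAt (w : ℕ → ℝ) (i : ℕ) (a : ℝ) (l : ℕ) : ℝ :=
  if l < i then w l else if l = i then w i + w (i + 1) - a else w (l + 1)

/-- The order embedding of `ℕ` into itself whose range omits exactly `i`. -/
def skipAt (i l : ℕ) : ℕ := if l < i then l else l + 1

open Finset in
theorem sum_range_mergeAt (w : ℕ → ℝ) (i : ℕ) (a : ℝ) (k : ℕ) :
    ∑ l ∈ range k, mergeAt w i a l =
      if k ≤ i then ∑ l ∈ range k, w l else ∑ l ∈ range (k + 1), w l - a := by
  induction k with
  | zero => simp
  | succ k ih =>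
    rw [sum_range_succ, ih, mergeAt]
    rcases lt_trichotomy k i with h | h | h
    · rw [if_pos h.le, if_pos h, if_pos (by omega), sum_range_succ]
    · subst h
      rw [if_pos le_rfl, if_neg (lt_irrefl k), if_pos rfl, if_neg (by omega), sum_range_succ,
        sum_range_succ]
      ring
    · rw [if_neg (by omega), if_neg (by omega), if_neg (by omega), if_neg (by omega),
        sum_range_succ _ (k + 1)]
      ring

open Finset in
theorem sum_range_skipAt (c : ℕ → ℝ) {i m : ℕ} (hi : i ≤ m) :
    ∑ l ∈ range m, c (skipAt i l) = ∑ l ∈ range (m + 1), c l - c i := by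
  have key : ∀ k, ∑ l ∈ range k, c (skipAt i l) =
      if k ≤ i then ∑ l ∈ range k, c l else ∑ l ∈ range (k + 1), c l - c i := by
    intro k
    induction k with
    | zero => simp
    | succ k ih =>
      rw [sum_range_succ, ih, skipAt]
      rcases lt_trichotomy k i with h | h | h
      · rw [if_pos h.le, if_pos h, if_pos (by omega), sum_range_succ]
      · subst h
        rw [if_pos le_rfl, if_neg (lt_irrefl k), if_neg (by omega), sum_range_succ _ (k + 1),
          sum_range_succ]
        ring
      · rw [if_neg (by omega), if_neg (by omega), if_neg (by omega), sum_range_succ _ (k + 1)]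
        ring
  rw [key]
  split_ifs with h
  · obtain rfl : m = i := by omega
    rw [sum_range_succ]
    ring
  · rfl

open Finset in
/-- If `w` majorizes `v` and `c` interlaces `w` from below, the entries of `c` can be ordered so
that every prefix sum differs from that of `v` by an amount controlled by the interlacing. -/
theorem exists_order_of_majorizes (M : ℝ) (hM : 0 ≤ M) (m : ℕ) :
    ∀ v w c : ℕ → ℝ, (0 < m → w 0 ≤ M) → (∀ i < m, 0 ≤ c i) → (∀ i < m, c i ≤ w i) →
      (∀ i, i + 1 < m → w (i + 1) ≤ c i) →
      (∀ T ⊆ range m, ∑ j ∈ T, v j ≤ ∑ l ∈ range T.card, w l) →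
      ∑ j ∈ range m, v j = ∑ l ∈ range m, w l →
      ∃ σ : ℕ → ℕ, (∀ j < m, σ j < m) ∧ (∀ j < m, ∀ j' < m, σ j = σ j' → j = j') ∧
        ∀ k ≤ m, 0 ≤ ∑ j ∈ range k, (c (σ j) - v j) + ∑ l ∈ range m, (w l - c l) ∧
          ∑ j ∈ range k, (c (σ j) - v j) + ∑ l ∈ range m, (w l - c l) ≤ M := by
  induction m with
  | zero =>
    intro v w c _ _ _ _ _ _
    refine ⟨id, by simp, by simp, ?_⟩
    intro k hk
    obtain rfl : k = 0 := by omega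
    simpa using hM
  | succ m ih =>
    intro v w c hw0 hc0 hcw hwc hmaj htot
    have hgap0 : 0 ≤ ∑ l ∈ range (m + 1), (w l - c l) :=
      sum_nonneg fun l hl => sub_nonneg.2 (hcw l (mem_range.1 hl))
    have hgapM := sum_interlaced_gap_le (m + 1) w c M hM hw0 hc0 hwc
    rcases Nat.eq_zero_or_pos m with rfl | hm
    · refine ⟨id, by simp, by intros; omega, ?_⟩
      intro k hk
      rcases Nat.le_one_iff_eq_zero_or_eq_one.1 hk with rfl | rfl
      · simpa using And.intro hgap0 hgapM
      · simp only [zero_add, sum_range_one, id] at *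
        constructor <;> linarith
    · have hv0 : v 0 ≤ w 0 := by simpa using hmaj {0} (by simp)
      have hlast : w m ≤ v 0 := by
        have h1 := hmaj ((range m).map (addRightEmbedding 1)) (by
          intro a ha
          simp only [mem_map, mem_range, addRightEmbedding_apply] at *
          omega)
        rw [sum_map, card_map, card_range] at h1
        rw [sum_range_succ', sum_range_succ] at htot
        simp only [addRightEmbedding_apply] at h1
        linarith
      obtain ⟨i, him, hi1, hi2⟩ : ∃ i, i + 1 ≤ m ∧ w (i + 1) ≤ v 0 ∧ v 0 ≤ w i := by
        classical
        have hex : ∃ i, w (i + 1) ≤ v 0 := ⟨m - 1, by rwa [Nat.sub_add_cancel hm]⟩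
        refine ⟨Nat.find hex, ?_, Nat.find_spec hex, ?_⟩
        · have : Nat.find hex ≤ m - 1 := Nat.find_min' hex (by rwa [Nat.sub_add_cancel hm])
          omega
        · cases hf : Nat.find hex with
          | zero => exact hv0
          | succ q =>
            have : ¬ w (q + 1) ≤ v 0 := Nat.find_min hex (by omega)
            exact (not_le.1 this).le
      have hmerge : ∑ l ∈ range m, mergeAt w i (v 0) l = ∑ l ∈ range (m + 1), w l - v 0 := by
        rw [sum_range_mergeAt, if_neg (by omega)]
      obtain ⟨σ, hσm, hσi, hσ⟩ := ih (fun j => v (j + 1)) (mergeAt w i (v 0))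
        (fun l => c (skipAt i l)) (by
          intro _
          have := hw0 (by omega)
          unfold mergeAt
          split_ifs with h1 h2
          · exact this
          · subst h2
            linarith
          · omega) (by
          intro l hl
          exact hc0 _ (by unfold skipAt; split_ifs <;> omega)) (by
          intro l hl
          unfold mergeAt skipAt
          split_ifs with h1 h2
          · exact hcw l (by omega)
          · subst h2
            have := hcw (l + 1) (by omega)
            linarith
          · exact hcw _ (by omega)) (by
          intro l hl
          unfold mergeAt skipAt
          rcases lt_trichotomy (l + 1) i with h | h | h
          · rw [if_pos h, if_pos (by omega)]
            exact hwc l (by omega)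
          · rw [if_neg (by omega), if_pos h, if_pos (by omega)]
            have := hwc l (by omega)
            subst h
            linarith
          · rw [if_neg (by omega), if_neg (by omega), if_neg (by omega)]
            exact hwc (l + 1) (by omega)) (by
          intro T hT
          have hTm : ∀ a ∈ T, a < m := fun a ha => mem_range.1 (hT ha)
          rw [sum_range_mergeAt]
          split_ifs with h
          · have h1 := hmaj (T.map (addRightEmbedding 1)) (by
              intro a ha
              simp only [mem_map, addRightEmbedding_apply] at ha
              obtain ⟨b, hb, rfl⟩ := ha
              have := hTm b hb
              simp only [mem_range]
              omega)
            rw [sum_map, card_map] at h1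
            exact h1
          · have h0 : 0 ∉ T.map (addRightEmbedding 1) := by simp
            have h1 := hmaj (insert 0 (T.map (addRightEmbedding 1))) (by
              intro a ha
              simp only [mem_insert, mem_map, addRightEmbedding_apply] at ha
              rcases ha with rfl | ⟨b, hb, rfl⟩
              · simp
              · have := hTm b hb
                simp only [mem_range]
                omega)
            rw [card_insert_of_notMem h0, sum_insert h0, sum_map, card_map] at h1
            simp only [addRightEmbedding_apply] at h1
            linarith) (by
          rw [hmerge]
          rw [sum_range_succ'] at htot
          linarith)
      refine ⟨fun j => if j = 0 then i else skipAt i (σ (j - 1)), ?_, ?_, ?_⟩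
      · intro j hj
        dsimp only
        split_ifs with h
        · omega
        · have := hσm (j - 1) (by omega)
          unfold skipAt
          split_ifs <;> omega
      · intro j hj j' hj' h
        dsimp only at h
        unfold skipAt at h
        by_cases hj0 : j = 0 <;> by_cases hj0' : j' = 0
        · omega
        · rw [if_pos hj0, if_neg hj0'] at h
          split_ifs at h <;> omega
        · rw [if_neg hj0, if_pos hj0'] at h
          split_ifs at h <;> omega
        · rw [if_neg hj0, if_neg hj0'] at h
          have := hσi (j - 1) (by omega) (j' - 1) (by omega) (by split_ifs at h <;> omega)
          omega
      · intro k hk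
        cases k with
        | zero => simpa using And.intro hgap0 hgapM
        | succ k =>
          have h1 := hσ k (by omega)
          rw [sum_range_succ']
          simp only [Nat.add_eq_zero_iff, one_ne_zero, and_false, if_false, if_true,
            Nat.add_sub_cancel]
          rw [sum_sub_distrib (s := range m), hmerge, sum_range_skipAt c (by omega)] at h1
          rw [sum_sub_distrib (s := range (m + 1))]
          constructor <;> linarith [h1.1, h1.2]

open Finset in
/-- A weighted sum with weights in `[0, 1]` of total weight `k` is at most the sum of the `k`
largest values. -/
theorem sum_weighted_le_sum_range (m : ℕ) (x a : ℕ → ℝ) (hx : ∀ i j, i ≤ j → j < m → x j ≤ x i)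
    (k : ℕ) (hk : k ≤ m) (ha0 : ∀ i < m, 0 ≤ a i) (ha1 : ∀ i < m, a i ≤ 1)
    (hsum : ∑ i ∈ range m, a i = k) :
    ∑ i ∈ range m, a i * x i ≤ ∑ i ∈ range k, x i := by
  rcases Nat.eq_zero_or_pos k with rfl | hkpos
  · have hz : ∀ i ∈ range m, a i = 0 :=
      (sum_eq_zero_iff_of_nonneg fun i hi => ha0 i (mem_range.1 hi)).1 (by simpa using hsum)
    rw [sum_eq_zero fun i hi => by rw [hz i hi, zero_mul]]
    simp
  · set t := x (k - 1) with ht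
    have h1 : ∑ i ∈ range m, a i * (x i - t) ≤ ∑ i ∈ range m, if i < k then x i - t else 0 := by
      refine sum_le_sum fun i hi => ?_
      have hi := mem_range.1 hi
      split_ifs with h
      · have := hx i (k - 1) (by omega) (by omega)
        nlinarith [ha1 i hi]
      · have := hx (k - 1) i (by omega) hi
        nlinarith [ha0 i hi]
    have h2 : (∑ i ∈ range m, if i < k then x i - t else 0) = ∑ i ∈ range k, (x i - t) := by
      rw [← sum_filter]
      congr 1
      ext i
      simp only [mem_filter, mem_range]
      omega
    rw [h2] at h1
    simp only [mul_sub, sum_sub_distrib, ← sum_mul, hsum, sum_const, card_range,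
      nsmul_eq_mul] at h1
    linarith

open Finset in
/-- Increasing enumeration of a finite set `s`, under which the prefixes of `s` correspond to
initial segments of `ℕ`. -/
theorem exists_enumeration {n : ℕ} (s : Finset (Fin n)) {m : ℕ} (hs : s.card = m) (hm : 0 < m) :
    ∃ e : ℕ → Fin n, Set.BijOn e ↑(range m) ↑s ∧
      ∀ p : ℕ, ∃ K ≤ m, s.filter (fun j : Fin n => (j : ℕ) < p) = (range K).image e := by
  obtain ⟨e, he⟩ : ∃ e : ℕ → Fin n, ∀ k (hk : k < m), e k = s.orderEmbOfFin hs ⟨k, hk⟩ :=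
    ⟨fun k => if hk : k < m then s.orderEmbOfFin hs ⟨k, hk⟩ else s.orderEmbOfFin hs ⟨0, hm⟩,
      fun k hk => dif_pos hk⟩
  have hlt : ∀ k < m, ∀ k' < m, k < k' → (e k : ℕ) < e k' := by
    intro k hk k' hk' h
    rw [he k hk, he k' hk']
    exact (s.orderEmbOfFin hs).strictMono (Fin.mk_lt_mk.2 h)
  have hmem : ∀ k < m, e k ∈ s := fun k hk => by
    rw [he k hk]
    exact s.orderEmbOfFin_mem hs _
  have hsurj : ∀ j ∈ s, ∃ k < m, e k = j := by
    intro j hj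
    have : j ∈ Set.range (s.orderEmbOfFin hs) := by
      rw [range_orderEmbOfFin]
      exact hj
    obtain ⟨⟨k, hk⟩, hkj⟩ := this
    exact ⟨k, hk, by rw [he k hk, hkj]⟩
  refine ⟨e, ⟨fun k hk => hmem k (by simpa using hk), ?_, ?_⟩, ?_⟩
  · intro k hk k' hk' h
    have hk : k < m := by simpa using hk
    have hk' : k' < m := by simpa using hk'
    rcases lt_trichotomy k k' with hl | hl | hl
    · have := hlt k hk k' hk' hl
      rw [h] at this
      omega
    · exact hl
    · have := hlt k' hk' k hk hl
      rw [h] at this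
      omega
  · intro j hj
    obtain ⟨k, hk, rfl⟩ := hsurj j hj
    exact ⟨k, by simpa using hk, rfl⟩
  · intro p
    classical
    have hex : ∃ k, k = m ∨ p ≤ (e k : ℕ) := ⟨m, Or.inl rfl⟩
    have hK : Nat.find hex ≤ m := Nat.find_min' hex (Or.inl rfl)
    refine ⟨Nat.find hex, hK, ?_⟩
    ext j
    simp only [mem_filter, mem_image, mem_range]
    constructor
    · rintro ⟨hj, hjp⟩
      obtain ⟨k, hk, rfl⟩ := hsurj j hj
      refine ⟨k, ?_, rfl⟩
      by_contra! hle
      rcases Nat.find_spec hex with h | h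
      · omega
      · rcases hle.eq_or_lt with h' | h'
        · rw [h'] at h
          omega
        · have := hlt _ (by omega) k hk h'
          omega
    · rintro ⟨k, hk, rfl⟩
      have := Nat.find_min hex hk
      push Not at this
      exact ⟨hmem k (by omega), this.2⟩

open Finset in
/-- A doubly stochastic assignment of the values `x` to the slots `s` can be rounded to a
bijection whose prefix sums exceed the fractional ones by an amount in `[0, x 0]`. -/
theorem exists_rounding {n m : ℕ} (hm : 0 < m) (x : Fin m → ℝ) (hx : Antitone x)
    (hxpos : ∀ i, 0 < x i) (s : Finset (Fin n)) (hs : s.card = m) (z : Fin m → Fin n → ℝ)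
    (hz0 : ∀ i, ∀ j ∈ s, 0 ≤ z i j) (hrow : ∀ i, ∑ j ∈ s, z i j = 1)
    (hcol : ∀ j ∈ s, ∑ i, z i j = 1) :
    ∃ σ : Fin n → Fin m, Set.BijOn σ ↑s Set.univ ∧ ∀ p : ℕ,
      (∑ j ∈ s.filter (fun j : Fin n => (j : ℕ) < p), ∑ i, z i j * x i) ≤
        ∑ j ∈ s.filter (fun j : Fin n => (j : ℕ) < p), x (σ j) ∧
      ∑ j ∈ s.filter (fun j : Fin n => (j : ℕ) < p), x (σ j) ≤
        (∑ j ∈ s.filter (fun j : Fin n => (j : ℕ) < p), ∑ i, z i j * x i) + x ⟨0, hm⟩ := by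
  classical
  obtain ⟨e, he, hpre⟩ := exists_enumeration s hs hm
  obtain ⟨r, hr⟩ : ∃ r : ℕ → Fin m, ∀ k (hk : k < m), r k = ⟨k, hk⟩ :=
    ⟨fun k => if hk : k < m then ⟨k, hk⟩ else ⟨0, hm⟩, fun k hk => dif_pos hk⟩
  have hrfin : ∀ i : Fin m, r i = i := fun i => hr i i.2
  have hanti : ∀ i j, i ≤ j → j < m → x (r j) ≤ x (r i) := by
    intro i j hij hj
    rw [hr i (by omega), hr j hj]
    exact hx (by simpa using hij)
  have hsumr : ∀ f : Fin m → ℝ, ∑ i ∈ range m, f (r i) = ∑ i, f i := by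
    intro f
    rw [← Fin.sum_univ_eq_sum_range (fun k => f (r k))]
    simp only [hrfin]
  have hes : s = (range m).image e := by
    apply Finset.coe_injective
    rw [coe_image, he.image_eq]
  have hsum_image : ∀ T ⊆ range m, ∀ f : Fin n → ℝ, ∑ j ∈ T.image e, f j = ∑ k ∈ T, f (e k) :=
    fun T hT f => sum_image fun a ha b hb h => he.injOn (hT ha) (hT hb) h
  have hmem : ∀ k ∈ range m, e k ∈ s := fun k hk => he.mapsTo hk
  have hswap : ∀ T : Finset ℕ, ∑ k ∈ T, ∑ i, z i (e k) * x i
      = ∑ i ∈ range m, (∑ k ∈ T, z (r i) (e k)) * x (r i) := by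
    intro T
    rw [hsumr (fun i => (∑ k ∈ T, z i (e k)) * x i), sum_comm]
    simp only [sum_mul]
  have hrow' : ∀ i, ∑ k ∈ range m, z i (e k) = 1 := by
    intro i
    rw [← hsum_image _ subset_rfl (fun j => z i j), ← hes, hrow]
  obtain ⟨τ, hτm, hτi, hτ⟩ := exists_order_of_majorizes (x ⟨0, hm⟩) (hxpos _).le m
    (fun k => ∑ i, z i (e k) * x i) (fun k => x (r k)) (fun k => x (r k))
    (fun _ => by rw [hr 0 hm]) (fun i _ => (hxpos _).le) (fun _ _ => le_rfl)
    (fun i hi => hanti i (i + 1) (by omega) hi)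
    (by
      intro T hT
      rw [hswap]
      refine sum_weighted_le_sum_range m (fun k => x (r k)) _ hanti _ ?_ ?_ ?_ ?_
      · simpa using card_le_card hT
      · exact fun i _ => sum_nonneg fun k hk => hz0 _ _ (hmem k (hT hk))
      · intro i _
        rw [← hrow' (r i)]
        exact sum_le_sum_of_subset_of_nonneg hT fun k hk _ => hz0 _ _ (hmem k hk)
      · rw [hsumr (fun i => ∑ k ∈ T, z i (e k)), sum_comm,
          sum_congr rfl fun k hk => hcol _ (hmem k (hT hk))]
        simp)
    (by
      rw [hswap]
      simp only [hrow', one_mul])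
  simp only [sub_self, sum_const_zero, add_zero] at hτ
  have hinv : ∀ k < m, Function.invFunOn e ↑(range m) (e k) = k := fun k hk =>
    he.injOn.leftInvOn_invFunOn (by simpa using hk)
  refine ⟨fun j => r (τ (Function.invFunOn e ↑(range m) j)), ?_, ?_⟩
  · have hinj : Set.InjOn (fun j => r (τ (Function.invFunOn e ↑(range m) j))) ↑s := by
      intro j hj j' hj' h
      obtain ⟨k, hk, rfl⟩ := he.surjOn hj
      obtain ⟨k', hk', rfl⟩ := he.surjOn hj'
      have hk : k < m := by simpa using hk
      have hk' : k' < m := by simpa using hk'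
      dsimp only at h
      rw [hinv k hk, hinv k' hk', hr _ (hτm k hk), hr _ (hτm k' hk')] at h
      rw [hτi k hk k' hk' (by simpa using h)]
    refine ⟨Set.mapsTo_univ _ _, hinj, ?_⟩
    have himg : s.image (fun j => r (τ (Function.invFunOn e ↑(range m) j))) = univ :=
      eq_univ_of_card _ (by rw [card_image_of_injOn hinj, hs, Fintype.card_fin])
    rw [Set.SurjOn, ← coe_image, himg, coe_univ]
  · intro p
    obtain ⟨K, hK, hKp⟩ := hpre p
    have hsub : range K ⊆ range m := range_subset_range.2 hK
    rw [hKp, hsum_image _ hsub, hsum_image _ hsub]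
    have hround : ∑ k ∈ range K, x (r (τ (Function.invFunOn e ↑(range m) (e k)))) =
        ∑ k ∈ range K, x (r (τ k)) :=
      sum_congr rfl fun k hk => by rw [hinv k ((mem_range.1 hk).trans_le hK)]
    rw [hround]
    have h := hτ K hK
    rw [sum_sub_distrib] at h
    constructor <;> linarith [h.1, h.2]


/-- **LP rounding for the slated stock size problem.**
Given x-slots `Ix` and y-slots `Ixᶜ`, doubly stochastic fractional assignments
`zx` (of the `x`-values to the x-slots) and `zy` (of the `y`-values to the
y-slots) whose prefix values all lie in `[α, β]`, there are bijective integral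
assignments `σ` (x-values to x-slots) and `π` (y-values to y-slots) whose prefix
values all lie in `[α − y₁, β + x₁]`. -/
theorem slated_stock_size_rounding
    (nx ny n : ℕ) (hnx : 0 < nx) (hny : 0 < ny) (hn : n = nx + ny)
    (x : Fin nx → ℝ) (y : Fin ny → ℝ)
    (hx : Antitone x) (hy : Antitone y)
    (hxpos : ∀ i, 0 < x i) (hypos : ∀ i, 0 < y i)
    (Ix : Finset (Fin n)) (hIx : Ix.card = nx)
    (zx : Fin nx → Fin n → ℝ) (zy : Fin ny → Fin n → ℝ)
    (hzx01 : ∀ i, ∀ j ∈ Ix, 0 ≤ zx i j ∧ zx i j ≤ 1)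
    (hzxrow : ∀ i, ∑ j ∈ Ix, zx i j = 1)
    (hzxcol : ∀ j ∈ Ix, ∑ i, zx i j = 1)
    (hzy01 : ∀ i, ∀ j ∈ Ixᶜ, 0 ≤ zy i j ∧ zy i j ≤ 1)
    (hzyrow : ∀ i, ∑ j ∈ Ixᶜ, zy i j = 1)
    (hzycol : ∀ j ∈ Ixᶜ, ∑ i, zy i j = 1)
    (α β : ℝ)
    (hpre : ∀ p : ℕ, p ≤ n →
      α ≤ (∑ j ∈ Ix.filter (fun j : Fin n => (j : ℕ) < p), ∑ i, zx i j * x i)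
          - (∑ j ∈ Ixᶜ.filter (fun j : Fin n => (j : ℕ) < p), ∑ i, zy i j * y i) ∧
      (∑ j ∈ Ix.filter (fun j : Fin n => (j : ℕ) < p), ∑ i, zx i j * x i)
          - (∑ j ∈ Ixᶜ.filter (fun j : Fin n => (j : ℕ) < p), ∑ i, zy i j * y i) ≤ β) :
    ∃ (σ : Fin n → Fin nx) (π : Fin n → Fin ny),
      Set.BijOn σ ↑Ix Set.univ ∧ Set.BijOn π ↑(Ixᶜ) Set.univ ∧
      ∀ p : ℕ, p ≤ n →
        α - y ⟨0, hny⟩ ≤ (∑ j ∈ Ix.filter (fun j : Fin n => (j : ℕ) < p), x (σ j))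
            - (∑ j ∈ Ixᶜ.filter (fun j : Fin n => (j : ℕ) < p), y (π j)) ∧
        (∑ j ∈ Ix.filter (fun j : Fin n => (j : ℕ) < p), x (σ j))
            - (∑ j ∈ Ixᶜ.filter (fun j : Fin n => (j : ℕ) < p), y (π j)) ≤ β + x ⟨0, hnx⟩ := by
  obtain ⟨σ, hσ, hσp⟩ := exists_rounding hnx x hx hxpos Ix hIx zx (fun i j hj => (hzx01 i j hj).1)
    hzxrow hzxcol
  obtain ⟨π, hπ, hπp⟩ := exists_rounding hny y hy hypos Ixᶜ
    (by rw [Finset.card_compl, Fintype.card_fin]; omega) zy (fun i j hj => (hzy01 i j hj).1)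
    hzyrow hzycol
  refine ⟨σ, π, hσ, hπ, fun p hp => ?_⟩
  obtain ⟨h1, h2⟩ := hpre p hp
  obtain ⟨h3, h4⟩ := hσp p
  obtain ⟨h5, h6⟩ := hπp p
  constructor <;> linarith
end
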